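/- Let m ≤ n and let C be an invertible 2^n × 2^n complex matrix. Suppose there are functions ε : (ZMod 2)^m → ℂ with ε(t) ≠ 0 for all t, and a, b : (ZMod 2)^m → (ZMod 2)^n, such that C⁻¹ Z̃(t) C = ε(t) · X(a(t)) Z(b(t)) for every t ∈ (ZMod 2)^m. Then for every t with a(t) = 0 one has ε(t) ∈ {1, -1}, and for all t, t' with a(t) = 0 and a(t') = 0 one has ε(t + t') = ε(t) ε(t'). -/

import Mathlib

open Matrix BigOperators Complex

noncomputable section

/-- The 2×2 Pauli X matrix, indexed by `ZMod 2`. -/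
def pX : Matrix (ZMod 2) (ZMod 2) ℂ := !![0, 1; 1, 0]

/-- The 2×2 Pauli Z matrix, indexed by `ZMod 2`. -/
def pZ : Matrix (ZMod 2) (ZMod 2) ℂ := !![1, 0; 0, -1]

/-- `X(a) = X^{a_1} ⊗ ⋯ ⊗ X^{a_n}` as a `2^n × 2^n` matrix indexed by bit strings. -/
def XK {n : ℕ} (a : Fin n → ZMod 2) :
    Matrix (Fin n → ZMod 2) (Fin n → ZMod 2) ℂ :=
  Matrix.of fun y x => ∏ i, (pX ^ (a i).val) (y i) (x i)

/-- `Z(a) = Z^{a_1} ⊗ ⋯ ⊗ Z^{a_n}` as a `2^n × 2^n` matrix indexed by bit strings. -/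
def ZK {n : ℕ} (a : Fin n → ZMod 2) :
    Matrix (Fin n → ZMod 2) (Fin n → ZMod 2) ℂ :=
  Matrix.of fun y x => ∏ i, (pZ ^ (a i).val) (y i) (x i)

/-- Standard (computational) basis vector `e_x`. -/
def basisVec {ι : Type*} [DecidableEq ι] (x : ι) : ι → ℂ :=
  fun y => if y = x then 1 else 0

/-- Standard Hermitian inner product, conjugate-linear in the first argument. -/
def innerC {ι : Type*} [Fintype ι] (v w : ι → ℂ) : ℂ :=
  ∑ x, (starRingEnd ℂ) (v x) * w x

/-- Extension of a bit string in `(ZMod 2)^m` to `(ZMod 2)^n` by zeros (for `m ≤ n`). -/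
def extZ {n m : ℕ} (hm : m ≤ n) (t : Fin m → ZMod 2) : Fin n → ZMod 2 :=
  fun i => if h : (i : ℕ) < m then t ⟨i, h⟩ else 0

lemma ZMod.eq_zero_or_eq_one (u : ZMod 2) : u = 0 ∨ u = 1 := by
  revert u
  decide

lemma pZ_pow_apply (u y x : ZMod 2) :
    (pZ ^ u.val) y x = if y = x then (-1 : ℂ) ^ (u.val * x.val) else 0 := by
  have h00 : pZ 0 0 = 1 := rfl
  have h01 : pZ 0 1 = 0 := rfl
  have h10 : pZ 1 0 = 0 := rfl
  have h11 : pZ 1 1 = -1 := rfl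
  rcases ZMod.eq_zero_or_eq_one u with rfl | rfl <;>
    rcases ZMod.eq_zero_or_eq_one y with rfl | rfl <;>
    rcases ZMod.eq_zero_or_eq_one x with rfl | rfl <;>
    simp [h00, h01, h10, h11, ZMod.val_one]

lemma pX_pow_apply_zero_zero (u : ZMod 2) :
    (pX ^ u.val) 0 0 = if u = 0 then 1 else 0 := by
  have h00 : pX 0 0 = 0 := rfl
  rcases ZMod.eq_zero_or_eq_one u with rfl | rfl <;>
    simp [h00, ZMod.val_one]

lemma neg_one_pow_val_add_mul (u v x : ZMod 2) :
    (-1 : ℂ) ^ ((u + v).val * x.val) = (-1) ^ (u.val * x.val) * (-1) ^ (v.val * x.val) := by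
  rcases ZMod.eq_zero_or_eq_one u with rfl | rfl <;>
    rcases ZMod.eq_zero_or_eq_one v with rfl | rfl <;>
    rcases ZMod.eq_zero_or_eq_one x with rfl | rfl <;>
    simp [ZMod.val_one, CharTwo.add_self_eq_zero]

lemma ZK_eq_diagonal {n : ℕ} (a : Fin n → ZMod 2) :
    ZK a = diagonal fun x => ∏ i, (-1 : ℂ) ^ ((a i).val * (x i).val) := by
  ext y x
  rw [diagonal_apply]
  simp only [ZK, of_apply, pZ_pow_apply]
  split_ifs with h
  · simp [h]
  · obtain ⟨i, hi⟩ := Function.ne_iff.mp h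
    exact Finset.prod_eq_zero (Finset.mem_univ i) (if_neg hi)

lemma ZK_add {n : ℕ} (a b : Fin n → ZMod 2) : ZK (a + b) = ZK a * ZK b := by
  simp [ZK_eq_diagonal, neg_one_pow_val_add_mul, Finset.prod_mul_distrib]

@[simp]
lemma ZK_zero {n : ℕ} : ZK (0 : Fin n → ZMod 2) = 1 := by
  simp [ZK_eq_diagonal]

@[simp]
lemma ZK_apply_zero_zero {n : ℕ} (a : Fin n → ZMod 2) : ZK a 0 0 = 1 := by
  simp [ZK_eq_diagonal]

@[simp]
lemma XK_zero {n : ℕ} : XK (0 : Fin n → ZMod 2) = 1 := by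
  ext y x
  rw [one_apply]
  simp only [XK, of_apply, Pi.zero_apply, ZMod.val_zero, pow_zero, one_apply]
  split_ifs with h
  · simp [h]
  · obtain ⟨i, hi⟩ := Function.ne_iff.mp h
    exact Finset.prod_eq_zero (Finset.mem_univ i) (if_neg hi)

lemma XK_apply_zero_zero {n : ℕ} (a : Fin n → ZMod 2) :
    XK a 0 0 = if a = 0 then 1 else 0 := by
  simp [XK, pX_pow_apply_zero_zero, Finset.prod_ite_zero, funext_iff]

lemma XK_mul_ZK_apply_zero_zero {n : ℕ} (a b : Fin n → ZMod 2) :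
    (XK a * ZK b) 0 0 = if a = 0 then 1 else 0 := by
  rw [ZK_eq_diagonal, mul_diagonal, XK_apply_zero_zero]
  simp

lemma extZ_add {n m : ℕ} (hm : m ≤ n) (t t' : Fin m → ZMod 2) :
    extZ hm (t + t') = extZ hm t + extZ hm t' := by
  ext i
  by_cases h : (i : ℕ) < m <;> simp [extZ, h]

lemma extZ_zero {n m : ℕ} (hm : m ≤ n) : extZ hm (0 : Fin m → ZMod 2) = 0 := by
  ext i
  simp [extZ]

theorem stmt14 (n m : ℕ) (hm : m ≤ n)
    (C : Matrix (Fin n → ZMod 2) (Fin n → ZMod 2) ℂ) (hC : IsUnit C)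
    (ε : (Fin m → ZMod 2) → ℂ) (hε : ∀ t, ε t ≠ 0)
    (a b : (Fin m → ZMod 2) → (Fin n → ZMod 2))
    (hconj : ∀ t, C⁻¹ * ZK (extZ hm t) * C = ε t • (XK (a t) * ZK (b t))) :
    (∀ t, a t = 0 → ε t = 1 ∨ ε t = -1) ∧
    (∀ t t', a t = 0 → a t' = 0 → ε (t + t') = ε t * ε t') := by
  have hdet : IsUnit C.det := (isUnit_iff_isUnit_det C).mp hC
  have key : ∀ t t', a t = 0 → a t' = 0 →
      (C⁻¹ * ZK (extZ hm (t + t')) * C) 0 0 = ε t * ε t' := by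
    intro t t' h h'
    have hmul : C⁻¹ * ZK (extZ hm (t + t')) * C =
        (C⁻¹ * ZK (extZ hm t) * C) * (C⁻¹ * ZK (extZ hm t') * C) := by
      simp only [extZ_add, ZK_add, Matrix.mul_assoc, mul_nonsing_inv_cancel_left _ _ hdet]
    rw [hmul, hconj, hconj, h, h', XK_zero, one_mul, one_mul, smul_mul_smul_comm, ← ZK_add]
    simp
  refine ⟨fun t h => ?_, fun t t' h h' => ?_⟩
  · have hsq := key t t h h
    have htt : t + t = 0 := funext fun i => CharTwo.add_self_eq_zero (t i)
    rw [htt, extZ_zero, ZK_zero, mul_one, nonsing_inv_mul _ hdet,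
      one_apply_eq] at hsq
    exact mul_self_eq_one_iff.mp hsq.symm
  · have hprod := key t t' h h'
    rw [hconj, Matrix.smul_apply, XK_mul_ZK_apply_zero_zero] at hprod
    split_ifs at hprod
    · simpa using hprod
    · exact absurd (by simpa using hprod.symm) (mul_ne_zero (hε t) (hε t'))
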